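/- For every real ρ > 1 there exist a sequence of positive integers (m_l) and a sequence of positive integers (n_l) with n_l ≤ ⌊ρ^{m_l}⌋ for every l, such that (1/⌊ρ^{m_l}⌋) ∑_{k=1}^{⌊ρ^{m_l}⌋} μ(k) μ(k+n_l) → 0 as l → ∞. -/

import Mathlib

open Finset Filter Topology ArithmeticFunction

/-- The summatory function of `a` at `exp u`, divided by `exp u`. -/
noncomputable def scaledSum (a : ℕ → ℂ) (u : ℝ) : ℂ :=
  (Real.exp (-u) : ℂ) * ∑ k ∈ Finset.Icc 1 ⌊Real.exp u⌋₊, a k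

lemma norm_sum_Icc_le {a : ℕ → ℂ} (ha : ∀ n, ‖a n‖ ≤ 1) (N : ℕ) :
    ‖∑ k ∈ Finset.Icc 1 N, a k‖ ≤ N := by
  refine (norm_sum_le_of_le _ fun k _ => ha k).trans ?_
  simp

lemma norm_sum_Icc_sub_le {a : ℕ → ℂ} (ha : ∀ n, ‖a n‖ ≤ 1) {M N : ℕ} (h : M ≤ N) :
    ‖∑ k ∈ Finset.Icc 1 N, a k - ∑ k ∈ Finset.Icc 1 M, a k‖ ≤ (N : ℝ) - M := by
  induction N, h using Nat.le_induction with
  | base => simp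
  | succ N hN ih =>
    rw [Finset.sum_Icc_succ_top (by lia), add_sub_right_comm]
    refine (norm_add_le _ _).trans ?_
    push_cast
    linarith [ha (N + 1)]

lemma norm_scaledSum_le {a : ℕ → ℂ} (ha : ∀ n, ‖a n‖ ≤ 1) (u : ℝ) : ‖scaledSum a u‖ ≤ 1 := by
  rw [scaledSum, norm_mul, Complex.norm_real, Real.norm_of_nonneg (Real.exp_nonneg _)]
  calc Real.exp (-u) * ‖∑ k ∈ Finset.Icc 1 ⌊Real.exp u⌋₊, a k‖
      ≤ Real.exp (-u) * Real.exp u := by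
        gcongr
        exact (norm_sum_Icc_le ha _).trans (Nat.floor_le (Real.exp_nonneg _))
    _ = 1 := by rw [← Real.exp_add]; simp

lemma scaledSum_of_neg (a : ℕ → ℂ) {u : ℝ} (hu : u < 0) : scaledSum a u = 0 := by
  have : ⌊Real.exp u⌋₊ = 0 := Nat.floor_eq_zero.2 (Real.exp_lt_one_iff.2 hu)
  simp [scaledSum, this]

lemma measurable_scaledSum (a : ℕ → ℂ) : Measurable (scaledSum a) := by
  unfold scaledSum
  have h : Measurable fun u : ℝ => ∑ k ∈ Finset.Icc 1 ⌊Real.exp u⌋₊, a k :=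
    (measurable_from_top (f := fun n : ℕ => ∑ k ∈ Finset.Icc 1 n, a k)).comp
      (Nat.measurable_floor.comp Real.measurable_exp)
  exact Measurable.mul (by fun_prop) h

lemma norm_scaledSum_sub_le_of_le {a : ℕ → ℂ} (ha : ∀ n, ‖a n‖ ≤ 1) {u v : ℝ} (h : u ≤ v) :
    ‖scaledSum a v - scaledSum a u‖ ≤ 2 * (v - u) + Real.exp (-v) := by
  have hexp : 1 - Real.exp (u - v) ≤ v - u := by linarith [Real.add_one_le_exp (u - v)]
  have hfl : ⌊Real.exp u⌋₊ ≤ ⌊Real.exp v⌋₊ := Nat.floor_mono (Real.exp_le_exp.2 h)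
  set A := ∑ k ∈ Finset.Icc 1 ⌊Real.exp v⌋₊, a k
  set B := ∑ k ∈ Finset.Icc 1 ⌊Real.exp u⌋₊, a k
  have hB : ‖B‖ ≤ Real.exp u := (norm_sum_Icc_le ha _).trans (Nat.floor_le (Real.exp_nonneg _))
  have hAB : ‖A - B‖ ≤ Real.exp v - Real.exp u + 1 := by
    refine (norm_sum_Icc_sub_le ha hfl).trans ?_
    linarith [Nat.floor_le (Real.exp_nonneg v), Nat.lt_floor_add_one (Real.exp u)]
  have key : scaledSum a v - scaledSum a u
      = (Real.exp (-v) : ℂ) * (A - B) - ((Real.exp (-u) - Real.exp (-v) : ℝ) : ℂ) * B := by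
    simp only [scaledSum, A, B]; push_cast; ring
  have h1 : Real.exp (-v) ≤ Real.exp (-u) := Real.exp_le_exp.2 (by linarith)
  rw [key]
  refine (norm_sub_le _ _).trans ?_
  rw [norm_mul, norm_mul, Complex.norm_real, Complex.norm_real,
    Real.norm_of_nonneg (Real.exp_nonneg _), Real.norm_of_nonneg (sub_nonneg.2 h1)]
  calc _ ≤ Real.exp (-v) * (Real.exp v - Real.exp u + 1)
        + (Real.exp (-u) - Real.exp (-v)) * Real.exp u := by
        have := sub_nonneg.2 h1
        gcongr
    _ = 2 * (1 - Real.exp (u - v)) + Real.exp (-v) := by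
        have e1 : Real.exp (-v) * Real.exp v = 1 := by rw [← Real.exp_add]; simp
        have e2 : Real.exp (-u) * Real.exp u = 1 := by rw [← Real.exp_add]; simp
        have e3 : Real.exp (-v) * Real.exp u = Real.exp (u - v) := by
          rw [← Real.exp_add]; congr 1; ring
        linear_combination e1 + e2 - 2 * e3
    _ ≤ _ := by linarith

lemma norm_scaledSum_sub_le {a : ℕ → ℂ} (ha : ∀ n, ‖a n‖ ≤ 1) (u v : ℝ) :
    ‖scaledSum a v - scaledSum a u‖ ≤ 2 * |v - u| + Real.exp (-v) := by
  rcases le_total u v with h | h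
  · rw [abs_of_nonneg (by linarith)]
    exact norm_scaledSum_sub_le_of_le ha h
  · rw [norm_sub_rev, abs_of_nonpos (by linarith)]
    refine (norm_scaledSum_sub_le_of_le ha h).trans ?_
    have : Real.exp (-u) ≤ Real.exp (-v) := Real.exp_le_exp.2 (by linarith)
    linarith

lemma integrable_exp_mul_scaledSum {a : ℕ → ℂ} (ha : ∀ n, ‖a n‖ ≤ 1) {δ : ℝ} (hδ : 0 < δ) :
    MeasureTheory.Integrable fun u : ℝ => (Real.exp (-δ * u) : ℂ) * scaledSum a u := by
  have h := (integrableOn_exp_mul_Ioi (a := -δ) (by linarith) (-1)).integrable_indicator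
    measurableSet_Ioi
  refine h.mono' ?_ (Eventually.of_forall fun u => ?_)
  · exact ((by fun_prop : Measurable fun u : ℝ => (Real.exp (-δ * u) : ℂ)).mul
      (measurable_scaledSum a)).aestronglyMeasurable
  · by_cases hu : u < 0
    · rw [scaledSum_of_neg a hu]
      simp only [mul_zero, norm_zero]
      exact Set.indicator_nonneg (fun _ _ => Real.exp_nonneg _) _
    · rw [Set.indicator_of_mem (by simp; linarith), norm_mul, Complex.norm_real,
        Real.norm_of_nonneg (Real.exp_nonneg _)]
      exact mul_le_of_le_one_right (Real.exp_nonneg _) (norm_scaledSum_le ha u)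

open FourierTransform in
lemma fourier_exp_mul_scaledSum {a : ℕ → ℂ} (ha : ∀ n, ‖a n‖ ≤ 1) {δ : ℝ} (hδ : 0 < δ) (ξ : ℝ) :
    𝓕 (fun u : ℝ => (Real.exp (-δ * u) : ℂ) * scaledSum a u) ξ
      = LSeries a (1 + δ + 2 * Real.pi * ξ * Complex.I) /
        (1 + δ + 2 * Real.pi * ξ * Complex.I) := by
  set s : ℂ := 1 + δ + 2 * Real.pi * ξ * Complex.I with hs
  have hre : s.re = 1 + δ := by simp [hs]
  have hs0 : s ≠ 0 := by
    intro h; rw [h] at hre; simp at hre; linarith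
  have hO : (fun n ↦ ∑ k ∈ Finset.Icc 1 n, ‖a k‖) =O[atTop] fun n : ℕ ↦ (n : ℝ) ^ (1 : ℝ) := by
    refine Asymptotics.isBigO_of_le _ fun n => ?_
    rw [Real.norm_of_nonneg (Finset.sum_nonneg fun _ _ => norm_nonneg _), Real.rpow_one]
    refine (Finset.sum_le_card_nsmul _ _ 1 fun k _ => ha k).trans ?_
    simp
  rw [LSeries_eq_mul_integral' a zero_le_one (by rw [hre]; linarith) hO, mul_div_cancel_left₀ _ hs0,
    Real.fourier_real_eq_integral_exp_smul]
  have himg : Set.Ioi (1 : ℝ) = Real.exp '' Set.Ioi 0 := by simp [Real.image_exp_Ioi]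
  rw [himg, MeasureTheory.integral_image_eq_integral_abs_deriv_smul measurableSet_Ioi
    (fun x _ => (Real.hasDerivAt_exp x).hasDerivWithinAt) Real.exp_injective.injOn,
    ← MeasureTheory.setIntegral_eq_integral_of_forall_compl_eq_zero (s := Set.Ici 0),
    MeasureTheory.integral_Ici_eq_integral_Ioi]
  · refine MeasureTheory.setIntegral_congr_fun measurableSet_Ioi fun u _ => ?_
    simp only [scaledSum, smul_eq_mul, abs_of_pos (Real.exp_pos u), Complex.real_smul]
    have : ((Real.exp u : ℝ) : ℂ) ^ (-(s + 1)) = Complex.exp (-(s + 1) * u) := by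
      rw [Complex.cpow_def_of_ne_zero (by exact_mod_cast (Real.exp_pos u).ne'),
        ← Complex.ofReal_log (Real.exp_nonneg u), Real.log_exp, mul_comm]
    rw [this]
    have e : Complex.exp (↑(-2 * Real.pi * u * ξ) * Complex.I) *
        (Complex.exp (-δ * u) * Complex.exp (-u)) = Complex.exp u * Complex.exp (-(s + 1) * u) := by
      simp only [← Complex.exp_add, hs]; congr 1; push_cast; ring
    push_cast at e ⊢
    linear_combination (∑ k ∈ Finset.Icc 1 ⌊Real.exp u⌋₊, a k) * e
  · intro u hu
    rw [scaledSum_of_neg a (by simpa using hu)]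
    simp

section
open FourierTransform MeasureTheory

lemma fourier_mul_exp (Φ : ℝ → ℂ) (y u : ℝ) :
    𝓕 (fun ξ : ℝ => Φ ξ * Complex.exp ((2 * Real.pi * y * ξ : ℝ) * Complex.I)) u
      = 𝓕 Φ (u - y) := by
  simp only [Real.fourier_real_eq_integral_exp_smul, smul_eq_mul]
  refine integral_congr_ae (Eventually.of_forall fun ξ => ?_)
  simp only
  rw [mul_left_comm, ← Complex.exp_add, mul_comm]
  congr 2
  push_cast; ring

lemma integral_exp_mul_scaledSum_mul_fourier {a : ℕ → ℂ} (ha : ∀ n, ‖a n‖ ≤ 1) {G : ℂ → ℂ}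
    (hGa : ∀ s : ℂ, 1 < s.re → LSeries a s = G s) {Φ : ℝ → ℂ} (hc : Continuous Φ)
    (hs : HasCompactSupport Φ) (y : ℝ) {δ : ℝ} (hδ : 0 < δ) :
    ∫ u, (Real.exp (-δ * u) : ℂ) * scaledSum a u * 𝓕 Φ (u - y) =
      ∫ ξ : ℝ, G (1 + δ + 2 * Real.pi * ξ * Complex.I) / (1 + δ + 2 * Real.pi * ξ * Complex.I) *
        (Φ ξ * Complex.exp ((2 * Real.pi * y * ξ : ℝ) * Complex.I)) := by
  have hg : Integrable fun ξ : ℝ => Φ ξ * Complex.exp ((2 * Real.pi * y * ξ : ℝ) * Complex.I) :=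
    (by fun_prop : Continuous fun ξ : ℝ =>
      Φ ξ * Complex.exp ((2 * Real.pi * y * ξ : ℝ) * Complex.I)).integrable_of_hasCompactSupport
        hs.mul_right
  have key := VectorFourier.integral_fourierIntegral_smul_eq_flip (L := innerₗ ℝ)
      Real.continuous_fourierChar continuous_inner (integrable_exp_mul_scaledSum ha hδ) hg
  have key2 : ∫ ξ : ℝ, 𝓕 (fun u : ℝ => (Real.exp (-δ * u) : ℂ) * scaledSum a u) ξ *
        (Φ ξ * Complex.exp ((2 * Real.pi * y * ξ : ℝ) * Complex.I)) =
      ∫ u : ℝ, (Real.exp (-δ * u) : ℂ) * scaledSum a u *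
        𝓕 (fun ξ : ℝ => Φ ξ * Complex.exp ((2 * Real.pi * y * ξ : ℝ) * Complex.I)) u := by
    simpa using! key
  simp only [fourier_mul_exp] at key2
  rw [← key2]
  refine integral_congr_ae (Eventually.of_forall fun ξ => ?_)
  simp only
  rw [fourier_exp_mul_scaledSum ha hδ, hGa _ (by simp [hδ])]

lemma integral_scaledSum_mul_fourier {a : ℕ → ℂ} (ha : ∀ n, ‖a n‖ ≤ 1) {G : ℂ → ℂ}
    (hG : ContinuousOn G {s | 1 ≤ s.re})
    (hGa : ∀ s : ℂ, 1 < s.re → LSeries a s = G s) {Φ : ℝ → ℂ} (hc : Continuous Φ)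
    (hs : HasCompactSupport Φ) (hi : Integrable (𝓕 Φ)) (y : ℝ) :
    ∫ u, scaledSum a u * 𝓕 Φ (u - y) =
      ∫ ξ : ℝ, G (1 + 2 * Real.pi * ξ * Complex.I) / (1 + 2 * Real.pi * ξ * Complex.I) *
        (Φ ξ * Complex.exp ((2 * Real.pi * y * ξ : ℝ) * Complex.I)) := by
  set H : ℝ × ℝ → ℂ := fun p => G (1 + p.1 + 2 * Real.pi * p.2 * Complex.I) /
    (1 + p.1 + 2 * Real.pi * p.2 * Complex.I) with hH
  have hHc : ContinuousOn H {p | 0 ≤ p.1} := by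
    refine ContinuousOn.div (hG.comp (by fun_prop) fun p hp => ?_) (by fun_prop) fun p hp h0 => ?_
    · simpa using hp
    · have := congrArg Complex.re h0
      simp at this hp
      linarith
  have hlim : Tendsto (fun n : ℕ => 1 / ((n : ℝ) + 1)) atTop (𝓝 0) :=
    tendsto_one_div_add_atTop_nhds_zero_nat
  have hpos (n : ℕ) : 0 < 1 / ((n : ℝ) + 1) := by positivity
  have hle (n : ℕ) : 1 / ((n : ℝ) + 1) ≤ 1 := by
    rw [div_le_one (by positivity)]; linarith [n.cast_nonneg (α := ℝ)]
  have L : Tendsto (fun n : ℕ => ∫ u, (Real.exp (-(1 / ((n : ℝ) + 1)) * u) : ℂ) *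
      scaledSum a u * 𝓕 Φ (u - y)) atTop (𝓝 (∫ u, scaledSum a u * 𝓕 Φ (u - y))) := by
    refine tendsto_integral_of_dominated_convergence (fun u => ‖𝓕 Φ (u - y)‖) (fun n => ?_)
      (hi.comp_sub_right y).norm (fun n => Eventually.of_forall fun u => ?_)
      (Eventually.of_forall fun u => ?_)
    · exact ((by fun_prop : Measurable fun u : ℝ =>
        (Real.exp (-(1 / ((n : ℝ) + 1)) * u) : ℂ)).mul
        (measurable_scaledSum a)).aestronglyMeasurable.mul
        (hi.comp_sub_right y).aestronglyMeasurable
    · rw [norm_mul]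
      refine mul_le_of_le_one_left (norm_nonneg _) ?_
      by_cases hu : u < 0
      · simp [scaledSum_of_neg a hu]
      · rw [norm_mul, Complex.norm_real, Real.norm_of_nonneg (Real.exp_nonneg _)]
        refine mul_le_one₀ (Real.exp_le_one_iff.2 ?_) (norm_nonneg _) (norm_scaledSum_le ha u)
        nlinarith [hpos n]
    · have : Tendsto (fun n : ℕ => (Real.exp (-(1 / ((n : ℝ) + 1)) * u) : ℂ)) atTop
          (𝓝 ((Real.exp (-0 * u) : ℝ) : ℂ)) :=
        (Complex.continuous_ofReal.tendsto _).comp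
          ((Real.continuous_exp.tendsto _).comp (hlim.neg.mul_const u))
      simpa using (this.mul_const (scaledSum a u)).mul_const (𝓕 Φ (u - y))
  have R : Tendsto (fun n : ℕ => ∫ ξ : ℝ, H (1 / ((n : ℝ) + 1), ξ) *
      (Φ ξ * Complex.exp ((2 * Real.pi * y * ξ : ℝ) * Complex.I))) atTop
      (𝓝 (∫ ξ : ℝ, H (0, ξ) *
        (Φ ξ * Complex.exp ((2 * Real.pi * y * ξ : ℝ) * Complex.I)))) := by
    obtain ⟨C, hC⟩ := ((isCompact_Icc (a := (0 : ℝ)) (b := 1)).prod hs).exists_bound_of_continuousOn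
      (hHc.mono fun p hp => hp.1.1)
    have hm (t : ℝ) (ht : 0 ≤ t) : Continuous fun ξ => H (t, ξ) :=
      hHc.comp_continuous (by fun_prop) fun ξ => ht
    refine tendsto_integral_of_dominated_convergence (fun ξ => C * ‖Φ ξ‖) (fun n => ?_)
      ((hc.integrable_of_hasCompactSupport hs).norm.const_mul C)
      (fun n => Eventually.of_forall fun ξ => ?_) (Eventually.of_forall fun ξ => ?_)
    · exact ((hm _ (hpos n).le).mul (by fun_prop)).aestronglyMeasurable
    · rw [norm_mul, norm_mul, Complex.norm_exp_ofReal_mul_I, mul_one]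
      by_cases h0 : Φ ξ = 0
      · simp [h0]
      · gcongr
        exact hC _ ⟨⟨(hpos n).le, hle n⟩, subset_tsupport _ h0⟩
    · refine Tendsto.mul_const _ ?_
      refine (hHc (0, ξ) (by simp)).tendsto.comp (tendsto_nhdsWithin_iff.2 ⟨?_, ?_⟩)
      · exact hlim.prodMk_nhds tendsto_const_nhds
      · exact Eventually.of_forall fun n => (hpos n).le
  have := tendsto_nhds_unique L (R.congr fun n => ?_)
  · simpa [hH] using this
  · rw [integral_exp_mul_scaledSum_mul_fourier ha hGa hc hs y (hpos n)]

lemma tendsto_integral_scaledSum_mul_fourier {a : ℕ → ℂ} (ha : ∀ n, ‖a n‖ ≤ 1) {G : ℂ → ℂ}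
    (hG : ContinuousOn G {s | 1 ≤ s.re})
    (hGa : ∀ s : ℂ, 1 < s.re → LSeries a s = G s) {Φ : ℝ → ℂ} (hc : Continuous Φ)
    (hs : HasCompactSupport Φ) (hi : Integrable (𝓕 Φ)) :
    Tendsto (fun y => ∫ u, scaledSum a u * 𝓕 Φ (u - y)) atTop (𝓝 0) := by
  have h := (Real.zero_at_infty_fourier fun ξ : ℝ =>
    G (1 + 2 * Real.pi * ξ * Complex.I) / (1 + 2 * Real.pi * ξ * Complex.I) * Φ ξ).comp
      (tendsto_neg_atTop_atBot.mono_right atBot_le_cocompact)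
  refine h.congr fun y => ?_
  rw [integral_scaledSum_mul_fourier ha hG hGa hc hs hi, Function.comp,
    Real.fourier_real_eq_integral_exp_smul]
  refine integral_congr_ae (Eventually.of_forall fun ξ => ?_)
  simp only [smul_eq_mul]
  rw [mul_comm, mul_assoc]
  congr 4
  push_cast; ring

/-- Fourier kernels of unit mass whose first absolute moment is arbitrarily small. -/
lemma exists_fourier_kernel {ε : ℝ} (hε : 0 < ε) :
    ∃ Φ : ℝ → ℂ, Continuous Φ ∧ HasCompactSupport Φ ∧ Integrable (𝓕 Φ) ∧
      ∫ u, 𝓕 Φ u = 1 ∧ Integrable (fun u => |u| * ‖𝓕 Φ u‖) ∧ ∫ u, |u| * ‖𝓕 Φ u‖ ≤ ε := by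
  let b : ContDiffBump (0 : ℝ) := ⟨1, 2, one_pos, one_lt_two⟩
  have hb : ContDiff ℝ (⊤ : ℕ∞) fun x => (b x : ℂ) :=
    Complex.ofRealCLM.contDiff.comp b.contDiff
  have hbs : HasCompactSupport fun x => (b x : ℂ) :=
    b.hasCompactSupport.comp_left (g := fun x : ℝ => (x : ℂ)) rfl
  let Ψ : SchwartzMap ℝ ℂ := hbs.toSchwartzMap hb
  have hΨ0 : Ψ 0 = 1 := by
    change ((b 0 : ℝ) : ℂ) = 1
    rw [b.one_of_mem_closedBall (by simp [b])]; simp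
  have hΨs : HasCompactSupport Ψ := hbs
  have hint : ∫ u, 𝓕 Ψ u = 1 := by
    rw [← hΨ0]
    conv_rhs => rw [← FourierTransform.fourierInv_fourier_eq Ψ (F := SchwartzMap ℝ ℂ)]
    rw [SchwartzMap.fourierInv_coe, Real.fourierInv_eq]
    simp
  have hmom : Integrable fun u => |u| * ‖𝓕 Ψ u‖ := by
    have := (𝓕 Ψ).integrable_pow_mul volume 1
    simpa using this
  set M := ∫ u, |u| * ‖𝓕 Ψ u‖ with hM
  have hM0 : 0 ≤ M := integral_nonneg fun u => by positivity
  obtain ⟨T, hT, hT0⟩ : ∃ T : ℝ, M ≤ ε * T ∧ 0 < T :=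
    ⟨M / ε + 1, by field_simp; linarith, by positivity⟩
  have hF : 𝓕 (fun ξ : ℝ => Ψ (ξ / T)) = fun u => (T : ℂ) * 𝓕 Ψ (u * T) := by
    ext u
    rw [SchwartzMap.fourier_coe]
    simp only [Real.fourier_real_eq_integral_exp_smul]
    have := Measure.integral_comp_div (fun v : ℝ =>
      Complex.exp (↑(-2 * Real.pi * v * (u * T)) * Complex.I) • Ψ v) T
    rw [abs_of_pos hT0, Complex.real_smul] at this
    rw [← this]
    refine integral_congr_ae (Eventually.of_forall fun ξ => ?_)
    simp only
    congr 4
    field_simp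
  refine ⟨fun ξ => Ψ (ξ / T), by fun_prop, ?_, ?_, ?_, ?_, ?_⟩
  · simp only [div_eq_mul_inv]
    exact hΨs.comp_homeomorph (Homeomorph.mulRight₀ T⁻¹ (by positivity))
  · rw [hF]
    exact ((𝓕 Ψ).integrable.comp_mul_right' hT0.ne').const_mul _
  · rw [hF, integral_const_mul, Measure.integral_comp_mul_right (fun u => 𝓕 Ψ u), hint]
    rw [abs_of_pos (by positivity), Complex.real_smul]
    have : (T : ℂ) ≠ 0 := by exact_mod_cast hT0.ne'
    push_cast
    field_simp
  · rw [hF]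
    refine (hmom.comp_mul_right' hT0.ne').congr (Eventually.of_forall fun u => ?_)
    simp only
    rw [norm_mul, Complex.norm_real, abs_mul, Real.norm_eq_abs]; ring
  · rw [hF]
    have : (fun u : ℝ => |u| * ‖(T : ℂ) * 𝓕 Ψ (u * T)‖) =
        fun u => (fun v : ℝ => |v| * ‖𝓕 Ψ v‖) (u * T) := by
      ext u; simp only
      rw [norm_mul, Complex.norm_real, abs_mul, Real.norm_eq_abs]; ring
    rw [this, Measure.integral_comp_mul_right (fun v : ℝ => |v| * ‖𝓕 Ψ v‖) T,
      abs_of_pos (by positivity), smul_eq_mul, ← hM,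
      inv_mul_le_iff₀ hT0]
    linarith

lemma tendsto_scaledSum {a : ℕ → ℂ} (ha : ∀ n, ‖a n‖ ≤ 1) {G : ℂ → ℂ}
    (hG : ContinuousOn G {s | 1 ≤ s.re})
    (hGa : ∀ s : ℂ, 1 < s.re → LSeries a s = G s) :
    Tendsto (scaledSum a) atTop (𝓝 0) := by
  rw [NormedAddGroup.tendsto_nhds_zero]
  intro ε hε
  obtain ⟨Φ, hc, hs, hi, h1, hm, hmε⟩ := exists_fourier_kernel (show 0 < ε / 8 by positivity)
  set I := ∫ u, ‖𝓕 Φ u‖ with hI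
  have e1 : Tendsto (fun y : ℝ => Real.exp (-y) * I) atTop (𝓝 0) := by
    simpa using (Real.tendsto_exp_neg_atTop_nhds_zero).mul_const I
  have e2 := (tendsto_integral_scaledSum_mul_fourier ha hG hGa hc hs hi).norm
  rw [norm_zero] at e2
  filter_upwards [e1.eventually (gt_mem_nhds (show 0 < ε / 4 by positivity)),
    e2.eventually (gt_mem_nhds (show 0 < ε / 4 by positivity))] with y h3 h4
  have hiy := hi.comp_sub_right y
  have i1 : Integrable fun u => scaledSum a u * 𝓕 Φ (u - y) :=
    hiy.bdd_mul (measurable_scaledSum a).aestronglyMeasurable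
      (Eventually.of_forall (norm_scaledSum_le ha))
  have key : scaledSum a y = (∫ u, (scaledSum a y - scaledSum a u) * 𝓕 Φ (u - y)) +
      ∫ u, scaledSum a u * 𝓕 Φ (u - y) := by
    rw [← integral_add]
    · simp only [sub_mul, sub_add_cancel]
      rw [integral_const_mul, integral_sub_right_eq_self (fun u => 𝓕 Φ u), h1, mul_one]
    · simp only [sub_mul]
      exact (hiy.const_mul _).sub i1
    · exact i1
  have hb : ‖∫ u, (scaledSum a y - scaledSum a u) * 𝓕 Φ (u - y)‖ ≤
      ∫ u, (2 * (|u - y| * ‖𝓕 Φ (u - y)‖) + Real.exp (-y) * ‖𝓕 Φ (u - y)‖) := by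
    refine norm_integral_le_of_norm_le ?_ (Eventually.of_forall fun u => ?_)
    · exact ((hm.comp_sub_right y).const_mul 2).add (hiy.norm.const_mul _)
    · rw [norm_mul, ← mul_assoc, ← add_mul, abs_sub_comm]
      gcongr
      exact norm_scaledSum_sub_le ha u y
  rw [integral_add ((hm.comp_sub_right y).const_mul 2) (hiy.norm.const_mul _),
    integral_const_mul, integral_const_mul,
    integral_sub_right_eq_self (fun u => |u| * ‖𝓕 Φ u‖),
    integral_sub_right_eq_self (fun u => ‖𝓕 Φ u‖)] at hb
  rw [key]
  refine (norm_add_le _ _).trans_lt ?_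
  linarith

end

/-- A Tauberian theorem: if a bounded sequence has a Dirichlet series that extends continuously to
the closed half-plane `1 ≤ re s`, then the sequence has mean value zero. -/
theorem tendsto_sum_div_of_continuousOn_LSeries {a : ℕ → ℂ} (ha : ∀ n, ‖a n‖ ≤ 1) {G : ℂ → ℂ}
    (hG : ContinuousOn G {s | 1 ≤ s.re})
    (hGa : ∀ s : ℂ, 1 < s.re → LSeries a s = G s) :
    Tendsto (fun N : ℕ => (∑ k ∈ Finset.Icc 1 N, a k) / N) atTop (𝓝 0) := by
  have h := (tendsto_scaledSum ha hG hGa).comp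
    (Real.tendsto_log_atTop.comp tendsto_natCast_atTop_atTop)
  refine h.congr' ?_
  filter_upwards [eventually_gt_atTop 0] with N hN
  have : (0 : ℝ) < N := by exact_mod_cast hN
  simp only [Function.comp, scaledSum, Real.exp_neg, Real.exp_log this, Nat.floor_natCast]
  push_cast
  rw [div_eq_inv_mul]

lemma norm_moebius_le_one (n : ℕ) : ‖(moebius n : ℂ)‖ ≤ 1 := by
  rw [Complex.norm_intCast]
  exact_mod_cast abs_moebius_le_one (n := n)

lemma exists_continuousOn_inv_LFunction {q : ℕ} [NeZero q] (χ : DirichletCharacter ℂ q) :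
    ∃ G : ℂ → ℂ, ContinuousOn G {s | 1 ≤ s.re} ∧
      ∀ s : ℂ, 1 < s.re → G s = 1 / DirichletCharacter.LFunction χ s := by
  by_cases hχ : χ = 1
  · subst hχ
    have hne1 (s : ℂ) (h : s ≠ 1) : DirichletCharacter.LFunctionTrivChar₁ q s =
        (s - 1) * DirichletCharacter.LFunction (1 : DirichletCharacter ℂ q) s := by
      simp [DirichletCharacter.LFunctionTrivChar₁, Function.update_of_ne h,
        DirichletCharacter.LFunctionTrivChar]
    refine ⟨fun s => (s - 1) / DirichletCharacter.LFunctionTrivChar₁ q s, ?_, fun s hs => ?_⟩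
    · refine ContinuousOn.div (by fun_prop)
        (DirichletCharacter.differentiable_LFunctionTrivChar₁ q).continuous.continuousOn
        fun s hs => ?_
      by_cases h1 : s = 1
      · rw [h1]; exact DirichletCharacter.LFunctionTrivChar₁_apply_one_ne_zero q
      · rw [hne1 s h1]
        exact mul_ne_zero (sub_ne_zero.2 h1)
          (DirichletCharacter.LFunction_ne_zero_of_one_le_re _ (.inr h1) hs)
    · have h1 : s ≠ 1 := by rintro rfl; simp at hs
      have := sub_ne_zero.2 h1
      simp only [hne1 s h1]
      rw [← div_div, div_self this]
  · refine ⟨fun s => 1 / DirichletCharacter.LFunction χ s, ?_, fun s _ => rfl⟩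
    exact continuousOn_const.div
      (DirichletCharacter.differentiable_LFunction hχ).continuous.continuousOn
      fun s hs => DirichletCharacter.LFunction_ne_zero_of_one_le_re _ (.inl hχ) hs

lemma tendsto_sum_moebius_mul_dirichletCharacter {q : ℕ} [NeZero q] (χ : DirichletCharacter ℂ q) :
    Tendsto (fun N : ℕ => (∑ k ∈ Finset.Icc 1 N, (moebius k : ℂ) * χ k) / N) atTop (𝓝 0) := by
  obtain ⟨G, hG, hGL⟩ := exists_continuousOn_inv_LFunction χ
  refine tendsto_sum_div_of_continuousOn_LSeries (fun n => ?_) hG fun s hs => ?_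
  · rw [norm_mul]
    exact mul_le_one₀ (norm_moebius_le_one n) (norm_nonneg _) (χ.norm_le_one _)
  · rw [hGL s hs, DirichletCharacter.LFunction_eq_LSeries χ hs, eq_div_iff
      (DirichletCharacter.LSeries_ne_zero_of_one_lt_re χ hs),
      ← DirichletCharacter.LSeries.mul_mu_eq_one χ hs, mul_comm]
    congr 2
    ext n
    simp [mul_comm]

/-- `μ` is orthogonal to functions modulo `q` supported on units. -/
lemma tendsto_sum_moebius_mul_of_isUnit {q : ℕ} [NeZero q] {g : ZMod q → ℂ}
    (hg : ∀ b, ¬ IsUnit b → g b = 0) :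
    Tendsto (fun N : ℕ => (∑ k ∈ Finset.Icc 1 N, (moebius k : ℂ) * g k) / N) atTop (𝓝 0) := by
  have hφ : (q.totient : ℂ) ≠ 0 := by
    exact_mod_cast (Nat.totient_pos.2 (NeZero.pos q)).ne'
  have hexp (x : ZMod q) : g x = ∑ χ : DirichletCharacter ℂ q,
      (∑ b, g b * χ b⁻¹ / q.totient) * χ x := by
    have h1 (b : ZMod q) : g b * ∑ χ : DirichletCharacter ℂ q, χ b⁻¹ * χ x =
        if b = x then g b * q.totient else 0 := by
      by_cases hb : IsUnit b
      · rw [DirichletCharacter.sum_char_inv_mul_char_eq ℂ hb]; simp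
      · simp [hg b hb]
    have h2 : ∑ b, g b * ∑ χ : DirichletCharacter ℂ q, χ b⁻¹ * χ x = g x * q.totient := by
      simp [h1]
    rw [eq_comm, ← mul_left_inj' hφ, ← h2]
    simp_rw [Finset.sum_mul, Finset.mul_sum]
    rw [Finset.sum_comm]
    refine Finset.sum_congr rfl fun b _ => Finset.sum_congr rfl fun χ _ => ?_
    field_simp
  have := tendsto_finsetSum (Finset.univ : Finset (DirichletCharacter ℂ q)) fun χ _ =>
    (tendsto_sum_moebius_mul_dirichletCharacter χ).const_mul (∑ b, g b * χ b⁻¹ / q.totient)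
  simp only [mul_zero, Finset.sum_const_zero] at this
  refine this.congr fun N => ?_
  simp_rw [← mul_div_assoc, ← Finset.sum_div, Finset.mul_sum (s := Finset.Icc 1 N)]
  rw [Finset.sum_comm]
  congr 1
  refine Finset.sum_congr rfl fun k _ => ?_
  rw [hexp k, Finset.mul_sum]
  refine Finset.sum_congr rfl fun χ _ => ?_
  rw [mul_left_comm, Finset.sum_div]

lemma moebius_mul_of_gcd_eq {q d j : ℕ} (hq : q ≠ 0) (hd : d ∣ q) (g : ZMod q → ℂ) :
    (if Nat.gcd (d * j) q = d then (moebius (d * j) : ℂ) * g ((d * j : ℕ) : ZMod q) else 0) =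
      moebius d * (moebius j * {x | IsUnit x}.indicator (fun x => g (d * x)) (j : ZMod q)) := by
  obtain ⟨r, rfl⟩ := hd
  have hd0 : 0 < d := Nat.pos_of_ne_zero (left_ne_zero_of_mul hq)
  have hu : (j : ZMod (d * r)) ∈ {x | IsUnit x} ↔ Nat.Coprime j d ∧ Nat.Coprime j r := by
    rw [Set.mem_ofPred_eq, ZMod.isUnit_iff_coprime, Nat.coprime_mul_iff_right]
  have h1 : d * Nat.gcd j r = d ↔ Nat.Coprime j r := by
    rw [Nat.mul_eq_left hd0.ne']
  rw [Nat.gcd_mul_left]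
  by_cases hr : Nat.Coprime j r
  · rw [if_pos (h1.2 hr)]
    by_cases hc : Nat.Coprime j d
    · rw [Set.indicator_of_mem (hu.2 ⟨hc, hr⟩), isMultiplicative_moebius.map_mul_of_coprime hc.symm]
      push_cast
      ring
    · have : moebius (d * j) = 0 :=
        moebius_eq_zero_of_not_squarefree fun h => hc (Nat.coprime_of_squarefree_mul h).symm
      rw [this, Set.indicator_of_notMem fun h => hc (hu.1 h).1]
      simp
  · rw [if_neg fun h => hr (h1.1 h), Set.indicator_of_notMem fun h => hr (hu.1 h).2]
    simp

lemma sum_moebius_filter_gcd {q d : ℕ} (hq : q ≠ 0) (hd : d ∣ q) (g : ZMod q → ℂ) (N : ℕ) :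
    ∑ k ∈ Finset.Icc 1 N with Nat.gcd k q = d, (moebius k : ℂ) * g k =
      moebius d * ∑ j ∈ Finset.Icc 1 (N / d),
        (moebius j : ℂ) * {x | IsUnit x}.indicator (fun x => g (d * x)) (j : ZMod q) := by
  have hd0 : 0 < d := Nat.pos_of_dvd_of_pos hd (Nat.pos_of_ne_zero hq)
  rw [Finset.mul_sum]
  simp_rw [← moebius_mul_of_gcd_eq hq hd g]
  rw [← Finset.sum_filter]
  refine Finset.sum_nbij' (fun k => k / d) (fun j => d * j) ?_ ?_ ?_ ?_ ?_
  · intro k hk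
    simp only [Finset.mem_filter, Finset.mem_Icc] at hk ⊢
    have hdk : d ∣ k := hk.2 ▸ Nat.gcd_dvd_left k q
    rw [Nat.mul_div_cancel' hdk]
    exact ⟨⟨Nat.div_pos (Nat.le_of_dvd hk.1.1 hdk) hd0, Nat.div_le_div_right hk.1.2⟩, hk.2⟩
  · intro j hj
    simp only [Finset.mem_filter, Finset.mem_Icc] at hj ⊢
    refine ⟨⟨Nat.mul_pos hd0 hj.1.1, ?_⟩, hj.2⟩
    rw [mul_comm]
    exact (Nat.le_div_iff_mul_le hd0).1 hj.1.2
  · intro k hk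
    simp only [Finset.mem_filter] at hk
    exact Nat.mul_div_cancel' (hk.2 ▸ Nat.gcd_dvd_left k q)
  · intro j _
    exact Nat.mul_div_cancel_left j hd0
  · intro k hk
    simp only [Finset.mem_filter] at hk
    rw [Nat.mul_div_cancel' (hk.2 ▸ Nat.gcd_dvd_left k q)]

/-- `μ` is orthogonal to periodic functions. -/
lemma tendsto_sum_moebius_mul_periodic {q : ℕ} [NeZero q] (g : ZMod q → ℂ) :
    Tendsto (fun N : ℕ => (∑ k ∈ Finset.Icc 1 N, (moebius k : ℂ) * g k) / N) atTop (𝓝 0) := by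
  have hq := NeZero.ne q
  have hd (d : ℕ) (hd : d ∈ q.divisors) :
      Tendsto (fun N : ℕ => (∑ k ∈ Finset.Icc 1 N with Nat.gcd k q = d, (moebius k : ℂ) * g k) / N)
        atTop (𝓝 0) := by
    have hdq := Nat.dvd_of_mem_divisors hd
    have hd0 : d ≠ 0 := (Nat.pos_of_mem_divisors hd).ne'
    have h := (tendsto_sum_moebius_mul_of_isUnit
      (g := {x | IsUnit x}.indicator fun x : ZMod q => g (d * x))
      fun b hb => Set.indicator_of_notMem (s := {x | IsUnit x}) hb _).comp
      (Nat.tendsto_div_const_atTop hd0)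
    rw [tendsto_zero_iff_norm_tendsto_zero] at h ⊢
    refine squeeze_zero (fun _ => norm_nonneg _) (fun N => ?_) h
    rw [sum_moebius_filter_gcd hq hdq, Function.comp, norm_div, norm_div, norm_mul]
    rcases Nat.eq_zero_or_pos (N / d) with h0 | h0
    · simp [h0]
    · have : ((N / d : ℕ) : ℝ) ≤ N := by exact_mod_cast Nat.div_le_self N d
      simp only [Complex.norm_natCast]
      have h0' : (0 : ℝ) < (N / d : ℕ) := by exact_mod_cast h0
      gcongr
      exact mul_le_of_le_one_left (norm_nonneg _) (norm_moebius_le_one d)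
  have := tendsto_finsetSum q.divisors hd
  simp only [Finset.sum_const_zero] at this
  refine this.congr fun N => ?_
  rw [← Finset.sum_div, Finset.sum_fiberwise_of_maps_to]
  exact fun k _ => Nat.mem_divisors.2 ⟨Nat.gcd_dvd_right k q, hq⟩

lemma tendsto_sum_moebius_mul_exp_rat {q : ℕ} (hq : 0 < q) (a : ℤ) :
    Tendsto (fun N : ℕ => (∑ k ∈ Finset.Icc 1 N,
      (moebius k : ℂ) * Complex.exp (2 * Real.pi * Complex.I * (k * (a / q : ℝ)))) / N)
      atTop (𝓝 0) := by
  have : NeZero q := ⟨hq.ne'⟩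
  refine (tendsto_sum_moebius_mul_periodic (q := q)
    fun x => (ZMod.toCircle ((a : ZMod q) * x) : ℂ)).congr fun N => ?_
  congr 1
  refine Finset.sum_congr rfl fun k _ => ?_
  have : (a : ZMod q) * (k : ZMod q) = ((a * k : ℤ) : ZMod q) := by push_cast; rfl
  rw [this, ZMod.toCircle_intCast]
  congr 2
  push_cast
  ring

lemma sum_Icc_dvd {E : Type*} [AddCommMonoid E] (f : ℕ → E) (N : ℕ) {p : ℕ} (hp : 0 < p) :
    ∑ k ∈ Finset.Icc 1 N with p ∣ k, f k = ∑ j ∈ Finset.Icc 1 (N / p), f (p * j) := by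
  symm
  refine Finset.sum_bij (fun j _ => p * j) (fun j hj => ?_) (fun a _ b _ h => ?_) (fun k hk => ?_)
    fun _ _ => rfl
  · simp only [Finset.mem_Icc, Finset.mem_filter] at hj ⊢
    refine ⟨⟨Nat.mul_pos hp hj.1, ?_⟩, dvd_mul_right _ _⟩
    have := (Nat.le_div_iff_mul_le hp).1 hj.2
    rwa [mul_comm]
  · exact Nat.eq_of_mul_eq_mul_left hp h
  · simp only [Finset.mem_Icc, Finset.mem_filter] at hk
    obtain ⟨⟨h1, h2⟩, j, rfl⟩ := hk
    refine ⟨j, ?_, rfl⟩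
    simp only [Finset.mem_Icc]
    exact ⟨Nat.pos_of_mul_pos_left h1, (Nat.le_div_iff_mul_le hp).2 (by rwa [mul_comm])⟩

lemma sum_Icc_dvd_one (N : ℕ) {p : ℕ} (hp : 0 < p) :
    ∑ k ∈ Finset.Icc 1 N, (if p ∣ k then (1 : ℝ) else 0) = (N / p : ℕ) := by
  rw [← Finset.sum_filter, sum_Icc_dvd _ _ hp]; simp

/-- The Turán–Kubilius inequality for a finite set of primes. -/
lemma sum_sq_card_dvd_sub_le {P : Finset ℕ} (hP : ∀ p ∈ P, p.Prime) (N : ℕ) :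
    ∑ k ∈ Finset.Icc 1 N, (∑ p ∈ P, (if p ∣ k then (1 : ℝ) else 0) - ∑ p ∈ P, 1 / (p : ℝ)) ^ 2
      ≤ N * ∑ p ∈ P, 1 / (p : ℝ) + 2 * (∑ p ∈ P, 1 / (p : ℝ)) * #P := by
  set A := ∑ p ∈ P, 1 / (p : ℝ) with hA
  have hA0 : 0 ≤ A := Finset.sum_nonneg fun _ _ => by positivity
  have h1 : N * A - #P ≤ ∑ k ∈ Finset.Icc 1 N, ∑ p ∈ P, (if p ∣ k then (1 : ℝ) else 0) := by
    rw [Finset.sum_comm, hA, Finset.mul_sum, Finset.cast_card, ← Finset.sum_sub_distrib]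
    refine Finset.sum_le_sum fun p hp => ?_
    rw [sum_Icc_dvd_one _ (hP p hp).pos]
    have := Nat.lt_floor_add_one ((N : ℝ) / p)
    rw [Nat.floor_div_eq_div] at this
    rw [mul_one_div]; linarith
  have h2 : ∑ k ∈ Finset.Icc 1 N, (∑ p ∈ P, (if p ∣ k then (1 : ℝ) else 0)) ^ 2
      ≤ N * A ^ 2 + N * A := by
    calc _ = ∑ p ∈ P, ∑ q ∈ P, ∑ k ∈ Finset.Icc 1 N,
          (if p ∣ k then (1 : ℝ) else 0) * (if q ∣ k then (1 : ℝ) else 0) := by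
          simp_rw [sq, Finset.sum_mul_sum]
          rw [Finset.sum_comm]
          exact Finset.sum_congr rfl fun _ _ => Finset.sum_comm
      _ ≤ ∑ p ∈ P, ∑ q ∈ P,
          (N * (1 / (p : ℝ) * (1 / q)) + if q = p then N * (1 / (p : ℝ)) else 0) := by
          refine Finset.sum_le_sum fun p hp => Finset.sum_le_sum fun q hq => ?_
          split_ifs with h
          · subst h
            have : ∑ k ∈ Finset.Icc 1 N, (if q ∣ k then (1 : ℝ) else 0) *
                (if q ∣ k then (1 : ℝ) else 0) = (N / q : ℕ) := by
              rw [← sum_Icc_dvd_one _ (hP q hq).pos]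
              exact Finset.sum_congr rfl fun k _ => by split_ifs <;> simp
            rw [this]
            have h3 : ((N / q : ℕ) : ℝ) ≤ N / q := Nat.cast_div_le
            have : (0 : ℝ) ≤ N * (1 / (q : ℝ) * (1 / q)) := by positivity
            rw [mul_one_div (N : ℝ)]; linarith
          · have hc := (Nat.coprime_primes (hP p hp) (hP q hq)).2 (Ne.symm h)
            have : ∑ k ∈ Finset.Icc 1 N, (if p ∣ k then (1 : ℝ) else 0) *
                (if q ∣ k then (1 : ℝ) else 0) = (N / (p * q) : ℕ) := by
              rw [← sum_Icc_dvd_one _ (Nat.mul_pos (hP p hp).pos (hP q hq).pos)]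
              refine Finset.sum_congr rfl fun k _ => ?_
              have hd : p * q ∣ k ↔ p ∣ k ∧ q ∣ k :=
                ⟨fun h => ⟨dvd_of_mul_right_dvd h, dvd_of_mul_left_dvd h⟩,
                  fun h => hc.mul_dvd_of_dvd_of_dvd h.1 h.2⟩
              by_cases h1 : p ∣ k <;> by_cases h2 : q ∣ k <;> simp [hd, h1, h2]
            rw [this]
            have h3 : ((N / (p * q) : ℕ) : ℝ) ≤ N / (p * q : ℕ) := Nat.cast_div_le
            push_cast at h3
            rw [add_zero]
            refine h3.trans_eq (by rw [one_div_mul_one_div, mul_one_div])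
      _ = N * A ^ 2 + N * A := by
          simp_rw [Finset.sum_add_distrib, ← Finset.mul_sum, ← Finset.sum_mul]
          rw [← hA, sq]
          congr 1
          rw [hA, Finset.mul_sum]
          exact Finset.sum_congr rfl fun p hp => by simp [hp]
  have h3 : ∑ k ∈ Finset.Icc 1 N, (∑ p ∈ P, (if p ∣ k then (1 : ℝ) else 0) - A) ^ 2
      = ∑ k ∈ Finset.Icc 1 N, (∑ p ∈ P, (if p ∣ k then (1 : ℝ) else 0)) ^ 2
        - 2 * A * ∑ k ∈ Finset.Icc 1 N, ∑ p ∈ P, (if p ∣ k then (1 : ℝ) else 0) + N * A ^ 2 := by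
    rw [Finset.mul_sum, ← Finset.sum_sub_distrib]
    have : (N : ℝ) * A ^ 2 = ∑ k ∈ Finset.Icc 1 N, A ^ 2 := by simp
    rw [this, ← Finset.sum_add_distrib]
    exact Finset.sum_congr rfl fun k _ => by ring
  rw [h3]
  nlinarith

lemma norm_sum_mul_le_sqrt {ι : Type*} (s : Finset ι) (f g : ι → ℂ) (hf : ∀ i ∈ s, ‖f i‖ ≤ 1) :
    ‖∑ i ∈ s, f i * g i‖ ≤ √(#s * ∑ i ∈ s, ‖g i‖ ^ 2) := by
  refine Real.le_sqrt_of_sq_le ?_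
  have : ‖∑ i ∈ s, f i * g i‖ ≤ ∑ i ∈ s, ‖g i‖ :=
    norm_sum_le_of_le _ fun i hi => by
      rw [norm_mul]; exact mul_le_of_le_one_left (norm_nonneg _) (hf i hi)
  calc _ ≤ (∑ i ∈ s, ‖g i‖) ^ 2 := by gcongr
    _ ≤ _ := sq_sum_le_card_mul_sum_sq

lemma norm_moebius_mul_add_le {p : ℕ} (hp : p.Prime) (j : ℕ) :
    ‖(moebius (p * j) : ℂ) + moebius j‖ ≤ if p ∣ j then 1 else 0 := by
  split_ifs with h
  · have : moebius (p * j) = 0 := by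
      refine moebius_eq_zero_of_not_squarefree fun hs => ?_
      obtain ⟨i, rfl⟩ := h
      rw [← mul_assoc] at hs
      exact hp.not_isUnit (hs p (dvd_mul_right _ _))
    rw [this]; simpa using norm_moebius_le_one j
  · rw [isMultiplicative_moebius.map_mul_of_coprime ((Nat.Prime.coprime_iff_not_dvd hp).2 h),
      moebius_apply_prime hp]
    simp

lemma sum_norm_sq_le_of_offdiag {P : Finset ℕ} {F : ℕ → ℂ}
    (hF : ∀ n, ‖F n‖ ≤ 1) {K : ℝ} (hK : ∀ p ∈ P, ∀ q ∈ P, p ≠ q → ∀ M : ℕ,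
      ‖∑ j ∈ Finset.Icc 1 M, F (p * j) * (starRingEnd ℂ) (F (q * j))‖ ≤ K) (hK0 : 0 ≤ K) (N : ℕ) :
    ∑ j ∈ Finset.Icc 1 N, ‖∑ p ∈ P, if j ≤ N / p then F (p * j) else 0‖ ^ 2
      ≤ N * ∑ p ∈ P, 1 / (p : ℝ) + (#P : ℝ) ^ 2 * K := by
  have h0 : ((∑ j ∈ Finset.Icc 1 N, ‖∑ p ∈ P, if j ≤ N / p then F (p * j) else 0‖ ^ 2 : ℝ) : ℂ)
      = ∑ p ∈ P, ∑ q ∈ P, ∑ j ∈ Finset.Icc 1 N, (if j ≤ N / p then F (p * j) else 0) *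
        (starRingEnd ℂ) (if j ≤ N / q then F (q * j) else 0) := by
    push_cast
    simp_rw [← Complex.mul_conj', map_sum, Finset.sum_mul_sum]
    rw [Finset.sum_comm]
    exact Finset.sum_congr rfl fun _ _ => Finset.sum_comm
  have h1 (p : ℕ) (q : ℕ) : ∑ j ∈ Finset.Icc 1 N, (if j ≤ N / p then F (p * j) else 0) *
        (starRingEnd ℂ) (if j ≤ N / q then F (q * j) else 0)
      = ∑ j ∈ Finset.Icc 1 (min (N / p) (N / q)), F (p * j) * (starRingEnd ℂ) (F (q * j)) := by
    have hs : Finset.Icc 1 (min (N / p) (N / q)) =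
        {j ∈ Finset.Icc 1 N | j ≤ N / p ∧ j ≤ N / q} := by
      ext j
      have := Nat.div_le_self N p
      simp only [Finset.mem_Icc, Finset.mem_filter]
      omega
    rw [hs, Finset.sum_filter]
    refine Finset.sum_congr rfl fun j _ => ?_
    split_ifs <;> simp_all
  have h2 : ‖((∑ j ∈ Finset.Icc 1 N, ‖∑ p ∈ P, if j ≤ N / p then F (p * j) else 0‖ ^ 2 : ℝ) : ℂ)‖
      ≤ ∑ p ∈ P, ∑ q ∈ P, ((if q = p then N * (1 / (p : ℝ)) else 0) + K) := by
    rw [h0]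
    refine norm_sum_le_of_le _ fun p hp => norm_sum_le_of_le _ fun q hq => ?_
    rw [h1]
    split_ifs with h
    · subst h
      have h3 : ((N / q : ℕ) : ℝ) ≤ N / q := Nat.cast_div_le
      have := norm_sum_Icc_le (a := fun j => F (q * j) * (starRingEnd ℂ) (F (q * j)))
        (fun j => by
          rw [norm_mul, RCLike.norm_conj]; exact mul_le_one₀ (hF _) (norm_nonneg _) (hF _)) (N / q)
      rw [min_self, mul_one_div]
      linarith
    · rw [zero_add]; exact hK p hp q hq (Ne.symm h) _
  rw [Complex.norm_real] at h2
  refine (Real.le_norm_self _).trans (h2.trans_eq ?_)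
  simp_rw [Finset.sum_add_distrib]
  congr 1
  · rw [Finset.mul_sum]
    exact Finset.sum_congr rfl fun p hp => by simp [hp]
  · simp; ring

/-- Kátai's inequality for `μ` and a finite set of primes. -/
lemma katai_inequality {P : Finset ℕ} (hP : ∀ p ∈ P, p.Prime) {F : ℕ → ℂ}
    (hF : ∀ n, ‖F n‖ ≤ 1) {K : ℝ} (hK : ∀ p ∈ P, ∀ q ∈ P, p ≠ q → ∀ M : ℕ,
      ‖∑ j ∈ Finset.Icc 1 M, F (p * j) * (starRingEnd ℂ) (F (q * j))‖ ≤ K) (hK0 : 0 ≤ K) (N : ℕ) :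
    (∑ p ∈ P, 1 / (p : ℝ)) * ‖∑ k ∈ Finset.Icc 1 N, (moebius k : ℂ) * F k‖
      ≤ √(N * (N * ∑ p ∈ P, 1 / (p : ℝ) + 2 * (∑ p ∈ P, 1 / (p : ℝ)) * #P))
        + N * ∑ p ∈ P, 1 / (p : ℝ) ^ 2
        + √(N * (N * ∑ p ∈ P, 1 / (p : ℝ) + (#P : ℝ) ^ 2 * K)) := by
  set A := ∑ p ∈ P, 1 / (p : ℝ) with hA
  have hA0 : 0 ≤ A := Finset.sum_nonneg fun _ _ => by positivity
  set T := ∑ k ∈ Finset.Icc 1 N, ∑ p ∈ P, (if p ∣ k then (moebius k : ℂ) * F k else 0) with hT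
  set U := ∑ j ∈ Finset.Icc 1 N, (moebius j : ℂ) * ∑ p ∈ P, if j ≤ N / p then F (p * j) else 0
    with hU
  have hμF (k) : ‖(moebius k : ℂ) * F k‖ ≤ 1 := by
    rw [norm_mul]; exact mul_le_one₀ (norm_moebius_le_one _) (norm_nonneg _) (hF _)
  have h1 : ‖A * ∑ k ∈ Finset.Icc 1 N, (moebius k : ℂ) * F k - T‖
      ≤ √(N * (N * A + 2 * A * #P)) := by
    have : A * ∑ k ∈ Finset.Icc 1 N, (moebius k : ℂ) * F k - T
        = ∑ k ∈ Finset.Icc 1 N, ((moebius k : ℂ) * F k) *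
          ((-(∑ p ∈ P, (if p ∣ k then (1 : ℝ) else 0) - A) : ℝ) : ℂ) := by
      rw [hT, Finset.mul_sum, ← Finset.sum_sub_distrib]
      refine Finset.sum_congr rfl fun k _ => ?_
      rw [neg_sub, Complex.ofReal_sub, mul_sub, mul_comm (A : ℂ)]
      congr 1
      push_cast
      rw [Finset.mul_sum]
      exact Finset.sum_congr rfl fun p _ => by split_ifs <;> simp
    rw [this]
    refine (norm_sum_mul_le_sqrt _ _ _ fun k _ => hμF k).trans ?_
    simp only [Complex.norm_real, norm_neg, Real.norm_eq_abs, sq_abs, Nat.card_Icc,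
      add_tsub_cancel_right]
    gcongr
    exact sum_sq_card_dvd_sub_le hP N
  have h2 : ‖T + U‖ ≤ N * ∑ p ∈ P, 1 / (p : ℝ) ^ 2 := by
    have e1 : T = ∑ p ∈ P, ∑ j ∈ Finset.Icc 1 (N / p), (moebius (p * j) : ℂ) * F (p * j) := by
      rw [hT, Finset.sum_comm]
      refine Finset.sum_congr rfl fun p hp => ?_
      rw [← Finset.sum_filter, sum_Icc_dvd _ _ (hP p hp).pos]
    have e2 : U = ∑ p ∈ P, ∑ j ∈ Finset.Icc 1 (N / p), (moebius j : ℂ) * F (p * j) := by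
      simp_rw [hU, Finset.mul_sum]
      rw [Finset.sum_comm]
      refine Finset.sum_congr rfl fun p hp => ?_
      have hs : Finset.Icc 1 (N / p) = {j ∈ Finset.Icc 1 N | j ≤ N / p} := by
        ext j
        have := Nat.div_le_self N p
        simp only [Finset.mem_Icc, Finset.mem_filter]
        omega
      rw [hs, Finset.sum_filter]
      exact Finset.sum_congr rfl fun j _ => by split_ifs <;> simp
    rw [e1, e2, ← Finset.sum_add_distrib, Finset.mul_sum]
    refine norm_sum_le_of_le _ fun p hp => ?_
    rw [← Finset.sum_add_distrib]
    have h3 : ((N / p / p : ℕ) : ℝ) ≤ N * (1 / (p : ℝ) ^ 2) := by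
      rw [Nat.div_div_eq_div_mul, mul_one_div, sq]
      exact_mod_cast Nat.cast_div_le (α := ℝ) (m := N) (n := p * p)
    refine le_trans ?_ h3
    rw [← sum_Icc_dvd_one _ (hP p hp).pos]
    refine norm_sum_le_of_le _ fun j _ => ?_
    rw [← add_mul, norm_mul]
    exact (mul_le_of_le_one_right (norm_nonneg _) (hF _)).trans
      (norm_moebius_mul_add_le (hP p hp) j)
  have h3 : ‖U‖ ≤ √(N * (N * A + (#P : ℝ) ^ 2 * K)) := by
    refine (norm_sum_mul_le_sqrt _ _ _ fun k _ => norm_moebius_le_one k).trans ?_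
    simp only [Nat.card_Icc, add_tsub_cancel_right]
    gcongr
    exact sum_norm_sq_le_of_offdiag hF hK hK0 N
  calc A * ‖∑ k ∈ Finset.Icc 1 N, (moebius k : ℂ) * F k‖
      = ‖(A * ∑ k ∈ Finset.Icc 1 N, (moebius k : ℂ) * F k - T) + (T + U) - U‖ := by
        rw [show ∀ x : ℂ, x - T + (T + U) - U = x from fun x => by ring, norm_mul,
          Complex.norm_real, Real.norm_of_nonneg hA0]
    _ ≤ _ := (norm_sub_le _ _).trans (add_le_add ((norm_add_le _ _).trans (add_le_add h1 h2)) h3)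

lemma norm_geom_sum_Icc_mul_le {z : ℂ} (hz : ‖z‖ = 1) (M : ℕ) :
    ‖∑ j ∈ Finset.Icc 1 M, z ^ j‖ * ‖z - 1‖ ≤ 2 := by
  have h : (∑ j ∈ Finset.Icc 1 M, z ^ j) * (z - 1) = z ^ (M + 1) - z := by
    induction M with
    | zero => simp
    | succ M ih => rw [Finset.sum_Icc_succ_top (by omega), add_mul, ih]; ring
  rw [← norm_mul, h]
  refine (norm_sub_le _ _).trans ?_
  rw [norm_pow, hz]; norm_num

lemma norm_exp_two_pi_I_mul (x : ℝ) : ‖Complex.exp (2 * Real.pi * Complex.I * x)‖ = 1 := by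
  rw [show 2 * Real.pi * Complex.I * x = ((2 * Real.pi * x : ℝ) : ℂ) * Complex.I by push_cast; ring]
  exact Complex.norm_exp_ofReal_mul_I _

lemma exp_two_pi_I_mul_add_int (x : ℝ) (m : ℤ) :
    Complex.exp (2 * Real.pi * Complex.I * ((x + m : ℝ) : ℂ))
      = Complex.exp (2 * Real.pi * Complex.I * x) := by
  rw [show 2 * Real.pi * Complex.I * ((x + m : ℝ) : ℂ)
    = 2 * Real.pi * Complex.I * x + m * (2 * Real.pi * Complex.I) by push_cast; ring,
    Complex.exp_add, Complex.exp_int_mul_two_pi_mul_I, mul_one]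

lemma four_mul_abs_sub_round_le (θ : ℝ) :
    4 * |θ - round θ| ≤ ‖Complex.exp (2 * Real.pi * Complex.I * θ) - 1‖ := by
  have h : Complex.exp (2 * Real.pi * Complex.I * θ)
      = Complex.exp (Complex.I * ((2 * Real.pi * (θ - round θ) : ℝ) : ℂ)) := by
    rw [← exp_two_pi_I_mul_add_int θ (-round θ)]
    congr 1; push_cast; ring
  have h1 := abs_sub_round θ
  have hpi := Real.pi_pos
  rw [h, Complex.norm_exp_I_mul_ofReal_sub_one, norm_mul, Real.norm_eq_abs, Real.norm_eq_abs,
    show 2 * Real.pi * (θ - round θ) / 2 = Real.pi * (θ - round θ) by ring]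
  have h2 : |Real.pi * (θ - round θ)| ≤ Real.pi / 2 := by
    rw [abs_mul, abs_of_pos hpi]; nlinarith
  have h3 := Real.mul_abs_le_abs_sin h2
  rw [abs_mul, abs_of_pos hpi, ← mul_assoc, div_mul_cancel₀ _ hpi.ne'] at h3
  rw [abs_of_pos (by norm_num : (0 : ℝ) < 2)]
  linarith

lemma norm_exp_two_pi_I_mul_sub_one_le (θ : ℝ) :
    ‖Complex.exp (2 * Real.pi * Complex.I * θ) - 1‖ ≤ 2 * Real.pi * |θ| := by
  have := Real.norm_exp_I_mul_ofReal_sub_one_le (x := 2 * Real.pi * θ)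
  rw [Real.norm_eq_abs, abs_mul, abs_of_pos Real.two_pi_pos] at this
  refine le_trans (le_of_eq ?_) this
  congr 3; push_cast; ring

lemma eventually_forall_le_norm_le {F : ℕ → ℂ} (hF : ∀ n, ‖F n‖ ≤ n)
    (h : Tendsto (fun N : ℕ => F N / N) atTop (𝓝 0)) {ε : ℝ} (hε : 0 < ε) :
    ∀ᶠ N : ℕ in atTop, ∀ x ≤ N, ‖F x‖ ≤ ε * N := by
  obtain ⟨N₁, hN₁⟩ := eventually_atTop.1 (h.norm.eventually (gt_mem_nhds (by simpa using hε)))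
  filter_upwards [eventually_ge_atTop ⌈N₁ / ε⌉₊] with N hN x hx
  have hx' : (x : ℝ) ≤ N := by exact_mod_cast hx
  rcases lt_or_ge x N₁ with h1 | h1
  · have h2 := (div_le_iff₀ hε).1 (Nat.ceil_le.1 hN)
    have : (x : ℝ) ≤ N₁ := by exact_mod_cast h1.le
    linarith [hF x]
  · rcases Nat.eq_zero_or_pos x with rfl | h0
    · have := hF 0
      simp only [Nat.cast_zero] at this
      exact this.trans (by positivity)
    have h2 := hN₁ x h1
    have h0' : (0 : ℝ) < x := by exact_mod_cast h0
    rw [norm_div, Complex.norm_natCast, div_lt_iff₀ h0'] at h2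
    exact h2.le.trans (by gcongr)

lemma norm_sum_mul_exp_le {f : ℕ → ℂ} {N : ℕ} {B : ℝ}
    (hB : ∀ x ≤ N, ‖∑ k ∈ Finset.Icc 1 x, f k‖ ≤ B) (β : ℝ) :
    ‖∑ k ∈ Finset.Icc 1 N, f k * Complex.exp (2 * Real.pi * Complex.I * (k * β))‖
      ≤ B * (1 + N * (2 * Real.pi * |β|)) := by
  set z := Complex.exp (2 * Real.pi * Complex.I * β) with hz
  have hz1 : ‖z‖ = 1 := norm_exp_two_pi_I_mul β
  have he (k : ℕ) : Complex.exp (2 * Real.pi * Complex.I * (k * β)) = z ^ k := by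
    rw [hz, ← Complex.exp_nat_mul]; congr 1; ring
  simp_rw [he]
  have habel : ∑ k ∈ Finset.Icc 1 N, f k * z ^ k
      = (∑ k ∈ Finset.Icc 1 N, f k) * z ^ N
        - ∑ x ∈ Finset.range N, (∑ k ∈ Finset.Icc 1 x, f k) * (z ^ x * (z - 1)) := by
    clear hB
    induction N with
    | zero => simp
    | succ N ih =>
      rw [Finset.sum_Icc_succ_top (by omega), Finset.sum_Icc_succ_top (by omega), ih,
        Finset.sum_range_succ]
      ring
  have hB0 : 0 ≤ B := (norm_nonneg _).trans (hB 0 (Nat.zero_le _))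
  rw [habel]
  have h1 : ‖(∑ k ∈ Finset.Icc 1 N, f k) * z ^ N‖ ≤ B := by
    rw [norm_mul, norm_pow, hz1, one_pow, mul_one]; exact hB N le_rfl
  have h2 : ‖∑ x ∈ Finset.range N, (∑ k ∈ Finset.Icc 1 x, f k) * (z ^ x * (z - 1))‖
      ≤ ∑ x ∈ Finset.range N, B * (2 * Real.pi * |β|) := by
    refine norm_sum_le_of_le _ fun x hx => ?_
    rw [norm_mul, norm_mul, norm_pow, hz1, one_pow, one_mul]
    exact mul_le_mul (hB x (Finset.mem_range.1 hx).le) (norm_exp_two_pi_I_mul_sub_one_le β)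
      (norm_nonneg _) hB0
  rw [Finset.sum_const, Finset.card_range, nsmul_eq_mul] at h2
  exact (norm_sub_le _ _).trans (by linarith)

lemma eventually_norm_sum_moebius_mul_exp_near_rat (Q : ℕ) {D : ℝ} (hD : 0 ≤ D) {ε : ℝ}
    (hε : 0 < ε) :
    ∀ᶠ N : ℕ in atTop, ∀ α : ℝ, ∀ q ∈ Finset.Icc 1 Q, ∀ a : ℤ, |q * α - a| ≤ D / N →
      ‖∑ k ∈ Finset.Icc 1 N, (moebius k : ℂ) * Complex.exp (2 * Real.pi * Complex.I * (k * α))‖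
        ≤ ε * N := by
  have hpi := Real.pi_pos
  set δ := ε / (1 + 2 * Real.pi * D) with hδ
  have hδ0 : 0 < δ := by positivity
  have key : ∀ᶠ N : ℕ in atTop, ∀ q ∈ Finset.Icc 1 Q, ∀ r ∈ Finset.range q, ∀ x ≤ N,
      ‖∑ k ∈ Finset.Icc 1 x, (moebius k : ℂ) *
        Complex.exp (2 * Real.pi * Complex.I * (k * (((r : ℕ) : ℤ) / q : ℝ)))‖ ≤ δ * N := by
    rw [Filter.eventually_all_finset]
    intro q hq
    rw [Filter.eventually_all_finset]
    intro r _
    refine eventually_forall_le_norm_le (F := fun x => ∑ k ∈ Finset.Icc 1 x, (moebius k : ℂ) *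
        Complex.exp (2 * Real.pi * Complex.I * (k * (((r : ℕ) : ℤ) / q : ℝ))))
      (fun n => norm_sum_Icc_le (fun k => ?_) n)
      (tendsto_sum_moebius_mul_exp_rat (Finset.mem_Icc.1 hq).1 r) hδ0
    have := norm_exp_two_pi_I_mul (k * (((r : ℕ) : ℤ) / q : ℝ))
    push_cast at this ⊢
    rw [norm_mul, this, mul_one]
    exact norm_moebius_le_one k
  filter_upwards [key, eventually_gt_atTop 0] with N hN hN0 α q hq a ha
  have hq1 : 1 ≤ q := (Finset.mem_Icc.1 hq).1
  have hq0 : (0 : ℝ) < q := by exact_mod_cast hq1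
  have hN0' : (0 : ℝ) < N := by exact_mod_cast hN0
  have hr0 : 0 ≤ a % q := Int.emod_nonneg _ (by omega)
  have hrq : a % q < q := Int.emod_lt_of_pos _ (by omega)
  obtain ⟨r, hr⟩ := Int.eq_ofNat_of_zero_le hr0
  have ha' : (a : ℝ) = r + q * (a / q : ℤ) := by
    have := Int.emod_add_mul_ediv a q
    rw [hr] at this
    exact_mod_cast this.symm
  have hbd := norm_sum_mul_exp_le (hN q hq r (by simp; omega)) (α - a / q)
  have hβ : |α - a / q| ≤ D / N := by
    have : q * |α - a / q| = |q * α - a| := by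
      rw [← abs_of_pos hq0, ← abs_mul, abs_of_pos hq0]; congr 1; field_simp
    have h1 : (1 : ℝ) ≤ q := by exact_mod_cast hq1
    nlinarith [abs_nonneg (α - a / q)]
  have heq (k : ℕ) : (moebius k : ℂ) * Complex.exp (2 * Real.pi * Complex.I * (k * α))
      = (moebius k : ℂ) * Complex.exp (2 * Real.pi * Complex.I * (k * (((r : ℕ) : ℤ) / q : ℝ)))
        * Complex.exp (2 * Real.pi * Complex.I * (k * (α - a / q : ℝ))) := by
    rw [mul_assoc (moebius k : ℂ), ← Complex.exp_add]
    congr 1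
    rw [show (k * α : ℂ) = ((k * (α - (a / q : ℤ)) + (k * (a / q : ℤ) : ℤ) : ℝ) : ℂ) by
      push_cast; ring, exp_two_pi_I_mul_add_int]
    congr 1
    have h3 : α - (a / q : ℤ) = r / q + (α - a / q) := by
      rw [ha']; field_simp; ring
    rw [h3]; push_cast; ring
  simp_rw [heq]
  refine hbd.trans ?_
  have : (N : ℝ) * (2 * Real.pi * |α - a / q|) ≤ 2 * Real.pi * D := by
    have := (le_div_iff₀ hN0').1 hβ
    nlinarith
  calc δ * N * (1 + N * (2 * Real.pi * |α - a / q|)) ≤ δ * N * (1 + 2 * Real.pi * D) := by gcongr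
    _ = ε * N := by rw [hδ]; field_simp

lemma exists_finset_prime_le_sum_one_div (C : ℝ) :
    ∃ P : Finset ℕ, (∀ p ∈ P, p.Prime) ∧ C ≤ ∑ p ∈ P, 1 / (p : ℝ) := by
  have h := (not_summable_iff_tendsto_nat_atTop_of_nonneg (fun n =>
    Set.indicator_nonneg (fun _ _ => by positivity) n)).1 not_summable_one_div_on_primes
  obtain ⟨n, hn⟩ := (h.eventually_ge_atTop C).exists
  refine ⟨{p ∈ Finset.range n | p.Prime}, fun p hp => (Finset.mem_filter.1 hp).2, hn.trans_eq ?_⟩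
  rw [Finset.sum_filter]
  exact Finset.sum_congr rfl fun p _ => by simp [Set.indicator_apply]

/-- Davenport's theorem without a rate: `μ` is orthogonal to `k ↦ e(kα)`, uniformly in `α`. -/
lemma eventually_norm_sum_moebius_mul_exp_le {ε : ℝ} (hε : 0 < ε) :
    ∀ᶠ N : ℕ in atTop, ∀ α : ℝ,
      ‖∑ k ∈ Finset.Icc 1 N, (moebius k : ℂ) * Complex.exp (2 * Real.pi * Complex.I * (k * α))‖
        ≤ ε * N := by
  set B := ∑' n : ℕ, 1 / (n : ℝ) ^ 2 with hB
  have hB0 : 0 ≤ B := tsum_nonneg fun _ => by positivity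
  obtain ⟨P, hP, hPC⟩ := exists_finset_prime_le_sum_one_div (1 + ((3 + B) / ε) ^ 2)
  set A := ∑ p ∈ P, 1 / (p : ℝ) with hA
  have hA1 : 1 ≤ A := by nlinarith [sq_nonneg ((3 + B) / ε)]
  have hPB : ∑ p ∈ P, 1 / (p : ℝ) ^ 2 ≤ B :=
    (Real.summable_one_div_nat_pow.2 (by norm_num)).sum_le_tsum P fun _ _ => by positivity
  have hP0 : 0 < #P := Finset.card_pos.2 <| by
    by_contra h
    rw [Finset.not_nonempty_iff_eq_empty] at h
    rw [hA, h, Finset.sum_empty] at hA1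
    linarith
  have hP0' : (0 : ℝ) < #P := by exact_mod_cast hP0
  filter_upwards [eventually_norm_sum_moebius_mul_exp_near_rat (P.sup id) (sq_nonneg (#P : ℝ)) hε,
    eventually_ge_atTop (2 * #P)] with N hnear hN α
  have hN' : 2 * (#P : ℝ) ≤ N := by exact_mod_cast hN
  have hN0 : (0 : ℝ) < N := by linarith
  by_cases hex : ∃ p ∈ P, ∃ q ∈ P, q < p ∧
      ‖Complex.exp (2 * Real.pi * Complex.I * (((p : ℝ) - q) * α : ℝ)) - 1‖ < 2 * (#P : ℝ) ^ 2 / N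
  · obtain ⟨p, hp, q, hq, hqp, hlt⟩ := hex
    refine hnear α (p - q) (Finset.mem_Icc.2 ⟨by omega, ?_⟩) (round (((p : ℝ) - q) * α)) ?_
    · exact (Nat.sub_le _ _).trans (Finset.le_sup (f := id) hp)
    · have := four_mul_abs_sub_round_le (((p : ℝ) - q) * α)
      rw [Nat.cast_sub hqp.le]
      rw [mul_div_assoc] at hlt
      have : 0 ≤ (#P : ℝ) ^ 2 / N := by positivity
      linarith
  · push Not at hex
    have hsymm : ∀ p ∈ P, ∀ q ∈ P, p ≠ q → 2 * (#P : ℝ) ^ 2 / N ≤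
        ‖Complex.exp (2 * Real.pi * Complex.I * (((p : ℝ) - q) * α : ℝ)) - 1‖ := by
      intro p hp q hq hpq
      rcases lt_or_gt_of_ne hpq with h | h
      · refine (hex q hq p hp h).trans_eq ?_
        rw [← RCLike.norm_conj, map_sub, ← Complex.exp_conj]
        simp only [map_mul, Complex.conj_I, Complex.conj_ofReal, map_one, map_ofNat]
        congr 3; push_cast; ring
      · exact hex p hp q hq h
    have hF (n : ℕ) : ‖Complex.exp (2 * Real.pi * Complex.I * (n * α))‖ ≤ 1 := by
      have := norm_exp_two_pi_I_mul (n * α)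
      push_cast at this
      exact this.le
    have hkatai := katai_inequality hP
      (F := fun n : ℕ => Complex.exp (2 * Real.pi * Complex.I * (n * α))) hF
      (K := N / (#P : ℝ) ^ 2) (fun p hp q hq hpq M => ?_) (by positivity) N
    swap
    · have hterm (j : ℕ) : Complex.exp (2 * Real.pi * Complex.I * ((p * j : ℕ) * α)) *
          (starRingEnd ℂ) (Complex.exp (2 * Real.pi * Complex.I * ((q * j : ℕ) * α)))
          = Complex.exp (2 * Real.pi * Complex.I * (((p : ℝ) - q) * α : ℝ)) ^ j := by
        rw [← Complex.exp_conj, ← Complex.exp_add, ← Complex.exp_nat_mul]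
        simp only [map_mul, Complex.conj_I, Complex.conj_ofReal, map_ofNat, map_natCast]
        congr 1; push_cast; ring
      simp_rw [hterm]
      have h1 := norm_geom_sum_Icc_mul_le
        (norm_exp_two_pi_I_mul (((p : ℝ) - q) * α)) M
      have h2 := mul_le_mul_of_nonneg_left (hsymm p hp q hq hpq) (norm_nonneg
        (∑ j ∈ Finset.Icc 1 M,
          Complex.exp (2 * Real.pi * Complex.I * (((p : ℝ) - q) * α : ℝ)) ^ j))
      have h3 := h2.trans h1
      rw [← mul_div_assoc, div_le_iff₀ hN0] at h3
      rw [le_div_iff₀ (by positivity)]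
      linarith
    rw [← hA] at hkatai
    have hs : 0 < √A := Real.sqrt_pos.2 (by linarith)
    have hss : √A * √A = A := Real.mul_self_sqrt (by linarith)
    have hs1 : 1 ≤ √A := Real.one_le_sqrt.2 hA1
    have hr1 : √(N * (N * A + 2 * A * #P)) ≤ 3 / 2 * (N * √A) := by
      refine Real.sqrt_le_iff.2 ⟨by positivity, ?_⟩
      have : N * (N * A + 2 * A * #P) ≤ N * (N * A + A * N) := by
        gcongr ?_ * (?_ + ?_) <;> nlinarith
      nlinarith [mul_pos hN0 hN0]
    have hr2 : √(N * (N * A + (#P : ℝ) ^ 2 * (N / (#P : ℝ) ^ 2))) ≤ 3 / 2 * (N * √A) := by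
      refine Real.sqrt_le_iff.2 ⟨by positivity, ?_⟩
      rw [mul_div_cancel₀ _ (by positivity : (#P : ℝ) ^ 2 ≠ 0)]
      nlinarith [mul_pos hN0 hN0, mul_le_mul_of_nonneg_left hA1 (mul_pos hN0 hN0).le]
    set S := ‖∑ k ∈ Finset.Icc 1 N, (moebius k : ℂ) *
      Complex.exp (2 * Real.pi * Complex.I * (k * α))‖ with hS
    have h4 : A * S ≤ √A * ((3 + B) * N) := by
      have : N * ∑ p ∈ P, 1 / (p : ℝ) ^ 2 ≤ √A * (B * N) := by
        calc N * ∑ p ∈ P, 1 / (p : ℝ) ^ 2 ≤ N * B := by gcongr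
          _ ≤ √A * (B * N) := by nlinarith [mul_nonneg hB0 hN0.le]
      linarith
    have h5 : √A * S ≤ (3 + B) * N := by
      refine le_of_mul_le_mul_left ?_ hs
      rwa [← mul_assoc, hss]
    have h6 : (3 + B) / ε ≤ √A := Real.le_sqrt_of_sq_le (by linarith)
    rw [div_le_iff₀ hε] at h6
    have h7 : √A * S ≤ √A * (ε * N) := by nlinarith
    exact le_of_mul_le_mul_left h7 hs

lemma sum_pow_mul_conj_pow {ζ : ℂ} {M : ℕ} (hζ : IsPrimitiveRoot ζ M) {a b : ℕ} (ha : a < M)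
    (hb : b < M) :
    ∑ r ∈ Finset.range M, ζ ^ (r * a) * (starRingEnd ℂ) (ζ ^ (r * b))
      = if a = b then (M : ℂ) else 0 := by
  have hM : M ≠ 0 := by omega
  have hn : ‖ζ‖ = 1 := hζ.norm'_eq_one hM
  have hz : ζ ≠ 0 := hζ.ne_zero hM
  have hterm (r : ℕ) : ζ ^ (r * a) * (starRingEnd ℂ) (ζ ^ (r * b)) = (ζ ^ a / ζ ^ b) ^ r := by
    rw [← Complex.inv_eq_conj (by rw [norm_pow, hn, one_pow]), div_pow, ← pow_mul, ← pow_mul,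
      mul_comm a, mul_comm b, div_eq_mul_inv]
  simp_rw [hterm]
  split_ifs with h
  · subst h; simp [div_self (pow_ne_zero a hz)]
  · have hne : ζ ^ a / ζ ^ b ≠ 1 := fun h1 =>
      h (hζ.pow_inj ha hb ((div_eq_one_iff_eq (pow_ne_zero b hz)).1 h1))
    rw [geom_sum_eq hne, div_pow, ← pow_mul, ← pow_mul, mul_comm a, mul_comm b, pow_mul, pow_mul,
      hζ.pow_eq_one]
    simp

lemma sum_norm_sq_sum_mul_pow {ζ : ℂ} {M : ℕ} (hζ : IsPrimitiveRoot ζ M) {s : Finset ℕ}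
    (hs : ∀ k ∈ s, k < M) (f : ℕ → ℂ) :
    ∑ r ∈ Finset.range M, ‖∑ k ∈ s, f k * ζ ^ (r * k)‖ ^ 2 = M * ∑ k ∈ s, ‖f k‖ ^ 2 := by
  have : ((∑ r ∈ Finset.range M, ‖∑ k ∈ s, f k * ζ ^ (r * k)‖ ^ 2 : ℝ) : ℂ)
      = ((M * ∑ k ∈ s, ‖f k‖ ^ 2 : ℝ) : ℂ) := by
    push_cast
    simp_rw [← Complex.mul_conj', map_sum, Finset.sum_mul_sum]
    rw [Finset.sum_comm, Finset.mul_sum]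
    refine Finset.sum_congr rfl fun k hk => ?_
    rw [Finset.sum_comm]
    have h1 : ∀ l ∈ s, ∑ r ∈ Finset.range M,
        f k * ζ ^ (r * k) * (starRingEnd ℂ) (f l * ζ ^ (r * l))
        = if k = l then f k * (starRingEnd ℂ) (f l) * M else 0 := fun l hl => by
      rw [← mul_ite_zero, ← sum_pow_mul_conj_pow hζ (hs k hk) (hs l hl), Finset.mul_sum]
      exact Finset.sum_congr rfl fun r _ => by rw [map_mul]; ring
    rw [Finset.sum_congr rfl h1, Finset.sum_ite_eq, if_pos hk]
    ring
  exact_mod_cast this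

lemma sum_mul_conj_mul_conj {ζ : ℂ} {N : ℕ} (hζ : IsPrimitiveRoot ζ (2 * N + 1))
    (a b w : ℕ → ℂ) :
    ∑ r ∈ Finset.range (2 * N + 1), (∑ l ∈ Finset.Icc 1 (2 * N), b l * ζ ^ (r * l)) *
        ((starRingEnd ℂ) (∑ n ∈ Finset.Icc 1 N, w n * ζ ^ (r * n)) *
          (starRingEnd ℂ) (∑ k ∈ Finset.Icc 1 N, a k * ζ ^ (r * k)))
      = (2 * N + 1 : ℕ) * ∑ n ∈ Finset.Icc 1 N, (starRingEnd ℂ) (w n) *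
        ∑ k ∈ Finset.Icc 1 N, (starRingEnd ℂ) (a k) * b (k + n) := by
  have hexp (r : ℕ) : (∑ l ∈ Finset.Icc 1 (2 * N), b l * ζ ^ (r * l)) *
        ((starRingEnd ℂ) (∑ n ∈ Finset.Icc 1 N, w n * ζ ^ (r * n)) *
          (starRingEnd ℂ) (∑ k ∈ Finset.Icc 1 N, a k * ζ ^ (r * k)))
      = ∑ n ∈ Finset.Icc 1 N, ∑ k ∈ Finset.Icc 1 N, ∑ l ∈ Finset.Icc 1 (2 * N), b l * ζ ^ (r * l) *
        ((starRingEnd ℂ) (w n * ζ ^ (r * n)) * (starRingEnd ℂ) (a k * ζ ^ (r * k))) := by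
    rw [map_sum, map_sum, Finset.sum_mul_sum, Finset.mul_sum]
    refine Finset.sum_congr rfl fun n _ => ?_
    rw [Finset.mul_sum]
    exact Finset.sum_congr rfl fun k _ => Finset.sum_mul _ _ _
  simp_rw [hexp]
  rw [Finset.sum_comm, Finset.mul_sum]
  refine Finset.sum_congr rfl fun n hn => ?_
  rw [Finset.sum_comm, Finset.mul_sum, Finset.mul_sum]
  refine Finset.sum_congr rfl fun k hk => ?_
  rw [Finset.sum_comm]
  simp only [Finset.mem_Icc] at hn hk
  have h1 : ∀ l ∈ Finset.Icc 1 (2 * N),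
      ∑ r ∈ Finset.range (2 * N + 1), b l * ζ ^ (r * l) *
        ((starRingEnd ℂ) (w n * ζ ^ (r * n)) * (starRingEnd ℂ) (a k * ζ ^ (r * k)))
      = if l = k + n then ((2 * N + 1 : ℕ) : ℂ) *
        ((starRingEnd ℂ) (w n) * ((starRingEnd ℂ) (a k) * b l)) else 0 := by
    intro l hl
    simp only [Finset.mem_Icc] at hl
    have h2 := sum_pow_mul_conj_pow hζ (a := l) (b := k + n) (by omega) (by omega)
    have h3 : ∑ r ∈ Finset.range (2 * N + 1), b l * ζ ^ (r * l) *
        ((starRingEnd ℂ) (w n * ζ ^ (r * n)) * (starRingEnd ℂ) (a k * ζ ^ (r * k)))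
        = (starRingEnd ℂ) (w n) * ((starRingEnd ℂ) (a k) * b l) *
          ∑ r ∈ Finset.range (2 * N + 1), ζ ^ (r * l) * (starRingEnd ℂ) (ζ ^ (r * (k + n))) := by
      rw [Finset.mul_sum]
      refine Finset.sum_congr rfl fun r _ => ?_
      rw [map_mul, map_mul, mul_add r k n, pow_add, map_mul]; ring
    rw [h3, h2, mul_ite, mul_zero, mul_comm]
  rw [Finset.sum_congr rfl h1, Finset.sum_ite_eq', if_pos (by simp only [Finset.mem_Icc]; omega)]

lemma sum_sq_correlation_le {N : ℕ} {a : ℕ → ℝ} (ha : ∀ k, |a k| ≤ 1) {B : ℝ}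
    (hB : ∀ α : ℝ, ‖∑ k ∈ Finset.Icc 1 (2 * N),
      (a k : ℂ) * Complex.exp (2 * Real.pi * Complex.I * (k * α))‖ ≤ B) :
    ∑ n ∈ Finset.Icc 1 N, (∑ k ∈ Finset.Icc 1 N, a k * a (k + n)) ^ 2 ≤ B ^ 2 * N := by
  set w : ℕ → ℝ := fun n => ∑ k ∈ Finset.Icc 1 N, a k * a (k + n) with hw
  set V := ∑ n ∈ Finset.Icc 1 N, w n ^ 2 with hV
  set M : ℕ := 2 * N + 1 with hM
  have hM0 : (0 : ℝ) < M := by positivity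
  have hV0 : 0 ≤ V := Finset.sum_nonneg fun _ _ => sq_nonneg _
  obtain ⟨ζ, hζ, hexp⟩ : ∃ ζ : ℂ, IsPrimitiveRoot ζ M ∧ ∀ r l : ℕ,
      ζ ^ (r * l) = Complex.exp (2 * Real.pi * Complex.I * (l * (r / M : ℝ))) := by
    refine ⟨_, Complex.isPrimitiveRoot_exp M (by omega), fun r l => ?_⟩
    rw [← Complex.exp_nat_mul]
    congr 1; push_cast; ring
  set W : ℕ → ℂ := fun r => ∑ n ∈ Finset.Icc 1 N, (w n : ℂ) * ζ ^ (r * n)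
  set A : ℕ → ℂ := fun r => ∑ k ∈ Finset.Icc 1 N, (a k : ℂ) * ζ ^ (r * k)
  have hmem : ∀ k ∈ Finset.Icc 1 N, k < M := fun k hk => by
    simp only [Finset.mem_Icc] at hk; omega
  have hW : ∑ r ∈ Finset.range M, ‖W r‖ ^ 2 = M * V := by
    rw [sum_norm_sq_sum_mul_pow hζ hmem]
    simp [hV]
  have hA : ∑ r ∈ Finset.range M, ‖A r‖ ^ 2 ≤ M * N := by
    rw [sum_norm_sq_sum_mul_pow hζ hmem]
    gcongr
    refine (Finset.sum_le_sum (g := fun _ => (1 : ℝ)) fun k _ => ?_).trans_eq (by simp)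
    rw [Complex.norm_real, Real.norm_eq_abs]
    exact pow_le_one₀ (abs_nonneg _) (ha k)
  have hcub := sum_mul_conj_mul_conj hζ (fun k => (a k : ℂ)) (fun k => (a k : ℂ))
    (fun k => (w k : ℂ))
  have hrhs : ∑ n ∈ Finset.Icc 1 N, (starRingEnd ℂ) (w n : ℂ) *
      ∑ k ∈ Finset.Icc 1 N, (starRingEnd ℂ) (a k : ℂ) * (a (k + n) : ℂ) = (V : ℂ) := by
    simp only [Complex.conj_ofReal, hV]
    push_cast
    refine Finset.sum_congr rfl fun n _ => ?_
    rw [sq, hw]; push_cast; rfl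
  rw [hrhs] at hcub
  have hle : M * V ≤ B * ∑ r ∈ Finset.range M, ‖W r‖ * ‖A r‖ := by
    have h1 : M * V = ‖((M : ℕ) : ℂ) * (V : ℂ)‖ := by
      rw [norm_mul, Complex.norm_natCast, Complex.norm_real, Real.norm_of_nonneg hV0]
    rw [h1, ← hcub, Finset.mul_sum]
    refine norm_sum_le_of_le _ fun r _ => ?_
    rw [norm_mul, norm_mul, RCLike.norm_conj, RCLike.norm_conj]
    refine mul_le_mul_of_nonneg_right ?_ (by positivity)
    simp_rw [hexp]
    exact hB _
  have hcs := Finset.sum_mul_sq_le_sq_mul_sq (Finset.range M) (fun r => ‖W r‖) (fun r => ‖A r‖)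
  rw [hW] at hcs
  have h2 : (M * V) ^ 2 ≤ B ^ 2 * (M * V * (M * N)) := by
    calc (M * V) ^ 2 ≤ (B * ∑ r ∈ Finset.range M, ‖W r‖ * ‖A r‖) ^ 2 := by gcongr
      _ = B ^ 2 * (∑ r ∈ Finset.range M, ‖W r‖ * ‖A r‖) ^ 2 := by ring
      _ ≤ B ^ 2 * (M * V * (M * N)) := by
        gcongr
        exact hcs.trans (by gcongr)
  rcases hV0.eq_or_lt with h0 | h0
  · rw [← h0]; positivity
  · have : M ^ 2 * V * V ≤ M ^ 2 * V * (B ^ 2 * N) := by linarith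
    exact le_of_mul_le_mul_left this (by positivity)

lemma eventually_exists_abs_moebius_correlation_le {ε : ℝ} (hε : 0 < ε) :
    ∀ᶠ N : ℕ in atTop, ∃ n ∈ Finset.Icc 1 N,
      |∑ k ∈ Finset.Icc 1 N, (moebius k : ℝ) * moebius (k + n)| ≤ ε * N := by
  have h2 : Tendsto (fun N : ℕ => 2 * N) atTop atTop :=
    tendsto_id.const_mul_atTop' two_pos
  filter_upwards [h2.eventually (eventually_norm_sum_moebius_mul_exp_le (half_pos hε)),
    eventually_gt_atTop 0] with N hN hN0
  have hsum := sum_sq_correlation_le (N := N) (a := fun k => (moebius k : ℝ))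
    (fun k => by exact_mod_cast abs_moebius_le_one (n := k)) (B := ε * N) (fun α => by
      have := hN α
      push_cast at this ⊢
      linarith)
  obtain ⟨n, hn, hle⟩ := Finset.exists_le_of_sum_le (s := Finset.Icc 1 N)
    (f := fun n => (∑ k ∈ Finset.Icc 1 N, (moebius k : ℝ) * moebius (k + n)) ^ 2)
    (g := fun _ => (ε * N) ^ 2) ⟨1, by simp; omega⟩ (by simpa [mul_comm] using hsum)
  exact ⟨n, hn, abs_le_of_sq_le_sq hle (by positivity)⟩

lemma exists_tendsto_moebius_correlation_div :
    ∃ n : ℕ → ℕ, (∀ N, 0 < N → n N ∈ Finset.Icc 1 N) ∧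
      Tendsto (fun N : ℕ => (1 / (N : ℝ)) *
        ∑ k ∈ Finset.Icc 1 N, (moebius k : ℝ) * moebius (k + n N)) atTop (𝓝 0) := by
  have hmin (N : ℕ) : ∃ n, 0 < N → n ∈ Finset.Icc 1 N ∧ ∀ n' ∈ Finset.Icc 1 N,
      |∑ k ∈ Finset.Icc 1 N, (moebius k : ℝ) * moebius (k + n)|
        ≤ |∑ k ∈ Finset.Icc 1 N, (moebius k : ℝ) * moebius (k + n')| := by
    by_cases hN : 0 < N
    · obtain ⟨n, h⟩ := Finset.exists_min_image (Finset.Icc 1 N)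
        (fun n => |∑ k ∈ Finset.Icc 1 N, (moebius k : ℝ) * moebius (k + n)|) ⟨1, by simp; omega⟩
      exact ⟨n, fun _ => h⟩
    · exact ⟨0, fun h => absurd h hN⟩
  choose n hn using hmin
  refine ⟨n, fun N hN => (hn N hN).1, Metric.tendsto_nhds.2 fun ε hε => ?_⟩
  filter_upwards [eventually_exists_abs_moebius_correlation_le (half_pos hε),
    eventually_gt_atTop 0] with N hN hN0
  obtain ⟨n', hn', hle⟩ := hN
  have hN0' : (0 : ℝ) < N := by exact_mod_cast hN0
  rw [dist_zero_right, Real.norm_eq_abs, abs_mul, abs_of_pos (by positivity : 0 < 1 / (N : ℝ)),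
    one_div_mul_eq_div, div_lt_iff₀ hN0']
  have := ((hn N hN0).2 n' hn').trans hle
  nlinarith

/-- For every `ρ > 1` there are sequences of positive integers `(m_l)` and `(n_l)` with
`n_l ≤ ⌊ρ^{m_l}⌋` such that the self-correlations
`(1/⌊ρ^{m_l}⌋) ∑_{k=1}^{⌊ρ^{m_l}⌋} μ(k) μ(k+n_l)` tend to `0`. -/
theorem moebius_selfcorrelation_along_geometric (ρ : ℝ) (hρ : 1 < ρ) :
    ∃ m n : ℕ → ℕ, (∀ l, 0 < m l) ∧ (∀ l, 0 < n l) ∧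
      (∀ l, n l ≤ ⌊ρ ^ (m l)⌋₊) ∧
      Tendsto (fun l : ℕ =>
          (1 / (⌊ρ ^ (m l)⌋₊ : ℝ)) * ∑ k ∈ Finset.Icc 1 ⌊ρ ^ (m l)⌋₊,
            ((ArithmeticFunction.moebius k * ArithmeticFunction.moebius (k + n l) : ℤ) : ℝ))
        atTop (𝓝 0) := by
  obtain ⟨n, hn, hlim⟩ := exists_tendsto_moebius_correlation_div
  have hpos (l : ℕ) : 0 < ⌊ρ ^ (l + 1)⌋₊ := Nat.floor_pos.2 (one_le_pow₀ hρ.le)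
  have hmem (l : ℕ) := Finset.mem_Icc.1 (hn _ (hpos l))
  have htop : Tendsto (fun l : ℕ => ⌊ρ ^ (l + 1)⌋₊) atTop atTop :=
    tendsto_nat_floor_atTop.comp
      ((tendsto_pow_atTop_atTop_of_one_lt hρ).comp (tendsto_add_atTop_nat 1))
  refine ⟨fun l => l + 1, fun l => n ⌊ρ ^ (l + 1)⌋₊, fun l => l.succ_pos, fun l => (hmem l).1,
    fun l => (hmem l).2, ?_⟩
  simpa [Function.comp_def] using hlim.comp htop
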